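/- (Inexpressibility of a◁a▷¬a by sequential binary connectives) Let a ∈ A. There is no propositional statement built from atoms, T, and F using only negation ¬, left-sequential conjunction ⌐∧, and left-sequential disjunction ⌐∨ that is free-valuation congruent (=_fr) to a◁a▷¬a. -/

import Mathlib

/-- Propositional statements over atoms `A`: constants `T`, `F`, an atom `a`
for each `a ∈ A`, and the ternary conditional composition
`cond x y z = x ◁ y ▷ z` (with `y` the central condition). -/
inductive PS (A : Type) : Type where
  | tt : PS A
  | ff : PS A
  | atom : A → PS A
  | cond : PS A → PS A → PS A → PS A

/-- A valuation algebra (VA) over `A`. -/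
structure VA (A : Type) where
  Val : Type
  Tv : Val
  Fv : Val
  yd : A → Val → Bool
  dv : A → Val → Val
  yd_T : ∀ a, yd a Tv = true
  yd_F : ∀ a, yd a Fv = false
  dv_T : ∀ a, dv a Tv = Tv
  dv_F : ∀ a, dv a Fv = Fv

variable {A : Type}

mutual
  /-- Evaluation `P/H` of a propositional statement over a valuation `H`. -/
  def PS.eval (V : VA A) : PS A → V.Val → Bool
    | .tt, _ => true
    | .ff, _ => false
    | .atom a, H => V.yd a H
    | .cond p q r, H =>
        if PS.eval V q H then PS.eval V p (PS.deriv V q H)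
        else PS.eval V r (PS.deriv V q H)
  /-- The generalized derivative `∂_P(H)`. -/
  def PS.deriv (V : VA A) : PS A → V.Val → V.Val
    | .tt, H => H
    | .ff, H => H
    | .atom a, H => V.dv a H
    | .cond p q r, H =>
        if PS.eval V q H then PS.deriv V p (PS.deriv V q H)
        else PS.deriv V r (PS.deriv V q H)
end

/-- `K`-equivalence: equal evaluation results in all members of the class `K`. -/
def KEquiv (K : VA A → Prop) (P Q : PS A) : Prop :=
  ∀ V : VA A, K V → ∀ H : V.Val, PS.eval V P H = PS.eval V Q H

/-- A congruence with respect to conditional composition. -/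
def IsCondCongruence (R : PS A → PS A → Prop) : Prop :=
  Equivalence R ∧
    ∀ ⦃x x' y y' z z' : PS A⦄, R x x' → R y y' → R z z' →
      R (PS.cond x y z) (PS.cond x' y' z')

/-- `K`-congruence: the largest congruence contained in `K`-equivalence. -/
def KCong (K : VA A → Prop) (P Q : PS A) : Prop :=
  ∃ R : PS A → PS A → Prop,
    IsCondCongruence R ∧ (∀ x y, R x y → KEquiv K x y) ∧ R P Q

/-- Derivability (of closed equations) in equational logic from the axioms `CP`
together with an additional set `Ax` of equational axioms. -/
inductive Deriv (Ax : PS A → PS A → Prop) : PS A → PS A → Prop where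
  | ax {p q} : Ax p q → Deriv Ax p q
  | cp1 (x y) : Deriv Ax (.cond x .tt y) x
  | cp2 (x y) : Deriv Ax (.cond x .ff y) y
  | cp3 (x) : Deriv Ax (.cond .tt x .ff) x
  | cp4 (x y z u v) :
      Deriv Ax (.cond x (.cond y z u) v)
               (.cond (.cond x y v) z (.cond x u v))
  | refl (x) : Deriv Ax x x
  | symm {p q} : Deriv Ax p q → Deriv Ax q p
  | trans {p q r} : Deriv Ax p q → Deriv Ax q r → Deriv Ax p r
  | congr {x x' y y' z z'} : Deriv Ax x x' → Deriv Ax y y' → Deriv Ax z z' →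
      Deriv Ax (.cond x y z) (.cond x' y' z')

/-- No additional axioms: plain `CP`. -/
def NoAx : PS A → PS A → Prop := fun _ _ => False

/-- The class `fr` of free valuation algebras: all VAs. -/
def frK : VA A → Prop := fun _ => True

/-- The class `rp` of repetition-proof VAs. -/
def rpK (V : VA A) : Prop :=
  ∀ (a : A) (x : V.Val), V.yd a x = V.yd a (V.dv a x)

/-- The class `cr` of contractive VAs. -/
def crK (V : VA A) : Prop :=
  rpK V ∧ ∀ (a : A) (x : V.Val), V.dv a (V.dv a x) = V.dv a x

/-- The class `wm` of weakly memorizing VAs. -/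
def wmK (V : VA A) : Prop :=
  crK V ∧ ∀ (a b : A) (x : V.Val),
    V.yd b (V.dv a x) = V.yd a x →
      V.dv a (V.dv b (V.dv a x)) = V.dv b (V.dv a x) ∧
      V.yd a (V.dv b (V.dv a x)) = V.yd a x

/-- The class `mem` of memorizing VAs. -/
def memK (V : VA A) : Prop :=
  crK V ∧ ∀ (a b : A) (x : V.Val),
    V.dv a (V.dv b (V.dv a x)) = V.dv b (V.dv a x) ∧
    V.yd a (V.dv b (V.dv a x)) = V.yd a x

/-- The class `st` of static VAs. -/
def stK (V : VA A) : Prop :=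
  ∀ (a b : A) (x : V.Val), V.yd a (V.dv b x) = V.yd a x

/-- Terms built from atoms, `T` and `F` using only negation `¬x = F◁x▷T`,
left-sequential conjunction `x ⌐∧ y = y◁x▷F` and left-sequential
disjunction `x ⌐∨ y = T◁x▷y`. -/
inductive SeqTerm {A : Type} : PS A → Prop where
  | tt : SeqTerm .tt
  | ff : SeqTerm .ff
  | atom (a : A) : SeqTerm (.atom a)
  | neg {p : PS A} : SeqTerm p → SeqTerm (.cond .ff p .tt)
  | land {p q : PS A} : SeqTerm p → SeqTerm q → SeqTerm (.cond q p .ff)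
  | lor {p q : PS A} : SeqTerm p → SeqTerm q → SeqTerm (.cond .tt p q)

/-- Binary decision trees with unlabelled inner nodes. -/
inductive DecTree : Type where
  | leaf : Bool → DecTree
  | node : DecTree → DecTree → DecTree

namespace DecTree

/-- Replace the `true` leaves by `x` and the `false` leaves by `y`. -/
def graft : DecTree → DecTree → DecTree → DecTree
  | leaf b, x, y => if b then x else y
  | node l r, x, y => node (graft l x y) (graft r x y)

/-- The leaf reached by following a stream of answers. -/
def result : DecTree → (ℕ → Bool) → Bool
  | leaf b, _ => b
  | node l r, f => if f 0 then result l (fun n => f (n + 1)) else result r (fun n => f (n + 1))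

/-- The number of answers consumed on the way to the leaf. -/
def steps : DecTree → (ℕ → Bool) → ℕ
  | leaf _, _ => 0
  | node l r, f =>
      (if f 0 then steps l (fun n => f (n + 1)) else steps r (fun n => f (n + 1))) + 1

theorem result_graft (u x y : DecTree) (f : ℕ → Bool) :
    result (graft u x y) f =
      if result u f then result x (fun n => f (n + steps u f))
      else result y (fun n => f (n + steps u f)) := by
  induction u generalizing f with
  | leaf b => cases b <;> simp [graft, result, steps]
  | node l r hl hr =>
    cases h : f 0 <;> simp [graft, result, steps, h, hl, hr, add_assoc]

theorem steps_graft (u x y : DecTree) (f : ℕ → Bool) :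
    steps (graft u x y) f =
      steps u f + if result u f then steps x (fun n => f (n + steps u f))
      else steps y (fun n => f (n + steps u f)) := by
  induction u generalizing f with
  | leaf b => cases b <;> simp [graft, result, steps]
  | node l r hl hr =>
    cases h : f 0 <;> simp [graft, result, steps, h, hl, hr, add_assoc, add_comm 1]

theorem graft_true_false (u : DecTree) : graft u (leaf true) (leaf false) = u := by
  induction u with
  | leaf b => cases b <;> rfl
  | node l r hl hr => simp [graft, hl, hr]

/-- A node consumes an answer and a leaf does not, which the next answer detects. -/
theorem not_forall_next_answer_eq (l r : DecTree) :
    ¬ ∀ f : ℕ → Bool, f 0 = f (steps (node l r) f) := by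
  intro h
  simpa [steps] using h (fun n => decide (n = 0))

theorem eq_of_result_eq_of_next_answer_eq {u v : DecTree}
    (hres : ∀ f, result u f = result v f)
    (hnext : ∀ f : ℕ → Bool, f (steps u f) = f (steps v f)) : u = v := by
  induction u generalizing v with
  | leaf b =>
    cases v with
    | leaf c => rw [show b = c from hres fun _ => true]
    | node l r => exact (not_forall_next_answer_eq l r hnext).elim
  | node l r hl hr =>
    cases v with
    | leaf c => exact (not_forall_next_answer_eq l r fun f => (hnext f).symm).elim
    | node l' r' =>
      rw [hl (v := l') (fun f => ?_) (fun f => ?_), hr (v := r') (fun f => ?_) (fun f => ?_)]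
      · simpa [result] using hres (fun n => Nat.casesOn n false f)
      · simpa [steps] using hnext (fun n => Nat.casesOn n false f)
      · simpa [result] using hres (fun n => Nat.casesOn n true f)
      · simpa [steps] using hnext (fun n => Nat.casesOn n true f)

/-- The tree of `a ◁ a ▷ ¬a` for `b = true`, and of its negation for `b = false`. -/
def agree (b : Bool) : DecTree :=
  node (node (leaf b) (leaf !b)) (node (leaf !b) (leaf b))

theorem graft_false_true_eq_agree {u : DecTree} {b : Bool}
    (h : graft u (leaf false) (leaf true) = agree b) : u = agree !b := by
  have key : ∀ w : DecTree,
      graft (graft w (leaf false) (leaf true)) (leaf false) (leaf true) = w := by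
    intro w
    induction w with
    | leaf b => cases b <;> rfl
    | node l r hl hr => simp [graft, hl, hr]
  rw [← key u, h]
  cases b <;> rfl

theorem graft_leaf_right_eq_leaf {u x : DecTree} {c : Bool}
    (h : graft u x (leaf false) = leaf c) : u = leaf false ∨ u = leaf true ∧ x = leaf c := by
  rcases u with (_ | _) | _ <;> simp_all [graft]

theorem graft_leaf_left_eq_leaf {u y : DecTree} {c : Bool}
    (h : graft u (leaf true) y = leaf c) : u = leaf true ∨ u = leaf false ∧ y = leaf c := by
  rcases u with (_ | _) | _ <;> simp_all [graft]

theorem graft_leaf_right_eq_agree {u x : DecTree} {b : Bool}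
    (h : graft u x (leaf false) = agree b) : u = agree b ∨ x = agree b := by
  by_cases hx : x = leaf true
  · subst hx
    exact Or.inl (by rwa [graft_true_false] at h)
  · rcases u with (_ | _) | ⟨((_ | _) | ⟨l, l'⟩), ((_ | _) | ⟨r, r'⟩)⟩ <;>
      grind [graft, agree, graft_leaf_right_eq_leaf]

theorem graft_leaf_left_eq_agree {u y : DecTree} {b : Bool}
    (h : graft u (leaf true) y = agree b) : u = agree b ∨ y = agree b := by
  by_cases hy : y = leaf false
  · subst hy
    exact Or.inl (by rwa [graft_true_false] at h)
  · rcases u with (_ | _) | ⟨((_ | _) | ⟨l, l'⟩), ((_ | _) | ⟨r, r'⟩)⟩ <;>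
      grind [graft, agree, graft_leaf_left_eq_leaf]

end DecTree

open DecTree

/-- The evaluation tree of a propositional statement, with the atoms forgotten. -/
def PS.decTree {A : Type} : PS A → DecTree
  | .tt => leaf true
  | .ff => leaf false
  | .atom _ => node (leaf true) (leaf false)
  | .cond p q r => graft q.decTree p.decTree r.decTree

/-- Streams of answers, consumed one at a time by whatever atom is evaluated. -/
abbrev streamVA (A : Type) : VA A where
  Val := ℕ → Bool
  Tv := fun _ => true
  Fv := fun _ => false
  yd _ f := f 0
  dv _ f := fun n => f (n + 1)
  yd_T _ := rfl
  yd_F _ := rfl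
  dv_T _ := rfl
  dv_F _ := rfl

theorem PS.eval_deriv_streamVA {A : Type} (p : PS A) (f : ℕ → Bool) :
    PS.eval (streamVA A) p f = result p.decTree f ∧
      PS.deriv (streamVA A) p f = fun n => f (n + steps p.decTree f) := by
  induction p generalizing f with
  | tt => exact ⟨rfl, rfl⟩
  | ff => exact ⟨rfl, rfl⟩
  | atom a => cases h : f 0 <;> simp [PS.eval, PS.deriv, PS.decTree, result, steps, h]
  | cond p q r hp hq hr =>
    rw [PS.eval, PS.deriv, PS.decTree, result_graft _ _ _ f, (hq f).1, (hq f).2]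
    simp only [steps_graft]
    split_ifs <;> simp [hp, hr, add_assoc, add_comm (steps q.decTree f)]

theorem decTree_eq_of_kCong {A : Type} (a : A) {K : VA A → Prop} (hK : K (streamVA A))
    {p q : PS A} (h : KCong K p q) : p.decTree = q.decTree := by
  obtain ⟨R, ⟨heq, hcond⟩, hR, hpq⟩ := h
  refine eq_of_result_eq_of_next_answer_eq (fun f => ?_) (fun f => ?_)
  · have := hR _ _ hpq _ hK f
    rwa [(p.eval_deriv_streamVA f).1, (q.eval_deriv_streamVA f).1] at this
  · have := hR _ _ (hcond (heq.refl (.atom a)) hpq (heq.refl (.atom a))) _ hK f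
    rw [PS.eval, ite_self, PS.eval, PS.eval, ite_self, PS.eval, (p.eval_deriv_streamVA f).2,
      (q.eval_deriv_streamVA f).2] at this
    simpa using this

theorem SeqTerm.decTree_ne_agree {A : Type} {t : PS A} (ht : SeqTerm t) (b : Bool) :
    t.decTree ≠ agree b := by
  induction ht generalizing b with
  | tt => simp [PS.decTree, agree]
  | ff => simp [PS.decTree, agree]
  | atom a => simp [PS.decTree, agree]
  | neg _ hp => exact fun h => hp _ (graft_false_true_eq_agree h)
  | land _ _ hp hq => exact fun h => (graft_leaf_right_eq_agree h).elim (hp b) (hq b)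
  | lor _ _ hp hq => exact fun h => (graft_leaf_left_eq_agree h).elim (hp b) (hq b)

/-- **Inexpressibility of `a◁a▷¬a` by the sequential binary connectives**:
no term built from atoms, `T`, `F`, `¬`, `⌐∧` and `⌐∨` is free-valuation
congruent to `a ◁ a ▷ ¬a`. -/
theorem not_expressible_seq {A : Type} [Countable A] [Nontrivial A] (a : A) :
    ¬ ∃ t : PS A, SeqTerm t ∧
      KCong frK t (.cond (.atom a) (.atom a) (.cond .ff (.atom a) .tt)) := by
  rintro ⟨t, ht, h⟩
  exact ht.decTree_ne_agree true (decTree_eq_of_kCong a trivial h)
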